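/- Fix a positive integer N, partitions μ and ν of N, complex parameters c = (c_1,…,c_L) and d = (d_1,…,d_M), and a nonnegative integer D. Then H^D_{G_{c,d}}(μ,ν) = Σ (−1)^{Σ_{i=1}^{M} Σ_{j=1}^{J_i} ℓ*(ν^{(i,j)}) − Σ_{i=1}^{M} J_i} ( ∏_{i=1}^{L} c_i^{ℓ*(μ̃^{(i)})} ) ( ∏_{i=1}^{M} ∏_{j=1}^{J_i} d_i^{ℓ*(ν^{(i,j)})} ) H(μ̃^{(1)},…,μ̃^{(L)},ν^{(1,1)},…,ν^{(1,J_1)},…,ν^{(M,1)},…,ν^{(M,J_M)},μ,ν), where the sum runs over all L-tuples (μ̃^{(1)},…,μ̃^{(L)}) of arbitrary (possibly trivial) partitions of N together with all M-tuples of finite sequences 𝛎^{(i)} = (ν^{(i,1)},…,ν^{(i,J_i)}), of arbitrary lengths J_i ≥ 0, of nontrivial partitions of N, subject to Σ_{i=1}^{L} ℓ*(μ̃^{(i)}) + Σ_{i=1}^{M} Σ_{j=1}^{J_i} ℓ*(ν^{(i,j)}) = D. (Each summand is N! times the total weight of the corresponding equivalence class of doubly labelled, rationally weighted constellations; this identity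 is the combinatorial content of the theorem that the sum of the total weights of all such constellations reproduces the generating τ-function for rationally weighted Hurwitz numbers.) -/

import Mathlib

open scoped Classical

/-- The trivial partition `(1^N)` of `N`. -/
def trivialPartition (N : ℕ) : Nat.Partition N where
  parts := Multiset.replicate N 1
  parts_pos := by intro i hi; rw [Multiset.eq_of_mem_replicate hi]; norm_num
  parts_sum := by simp

/-- The colength `ℓ*(μ) = N - ℓ(μ)` of a partition of `N`. -/
def colength {N : ℕ} (μ : Nat.Partition N) : ℕ := N - Multiset.card μ.parts

/-- The cycle type (including fixed points as parts equal to 1) of a permutation of `Fin N`,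
as a multiset of parts. -/
def fullCycleType {N : ℕ} (h : Equiv.Perm (Fin N)) : Multiset ℕ :=
  h.cycleType + Multiset.replicate (N - h.cycleType.sum) 1

/-- `h` has cycle type `μ` (fixed points counting as parts equal to `1`). -/
def HasCycleType {N : ℕ} (h : Equiv.Perm (Fin N)) (μ : Nat.Partition N) : Prop :=
  fullCycleType h = μ.parts

/-- The number of tuples `(h_1, …, h_k)` of permutations of `{1,…,N}` with
`h_1 ⋯ h_k = 1` and the cycle type of `h_i` equal to the `i`-th entry of the list `μs`. -/
noncomputable def hurwitzCount (N : ℕ) (μs : List (Nat.Partition N)) : ℕ :=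
  Nat.card {h : Fin μs.length → Equiv.Perm (Fin N) //
    (List.ofFn h).prod = 1 ∧ ∀ i, HasCycleType (h i) (μs.get i)}

/-- The pure Hurwitz number `H(μ^{(1)}, …, μ^{(k)})`. -/
noncomputable def pureHurwitz (N : ℕ) (μs : List (Nat.Partition N)) : ℚ :=
  (hurwitzCount N μs : ℚ) / (Nat.factorial N : ℚ)

/-- The set `𝔐^{(N)}_{k,d}` of `k`-tuples of nontrivial partitions of `N`
with total colength `d`. -/
noncomputable def MMset (N k d : ℕ) : Finset (Fin k → Nat.Partition N) :=
  Finset.univ.filter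
    (fun μ => (∀ i, μ i ≠ trivialPartition N) ∧ ∑ i, colength (μ i) = d)

/-- The unsymmetrized weight `W_{c,d}(𝛍;𝛎)`. -/
noncomputable def Wun {N L M l m : ℕ} (c : Fin L → ℂ) (d : Fin M → ℂ)
    (μ : Fin l → Nat.Partition N) (ν : Fin m → Nat.Partition N) : ℂ :=
  (-1 : ℂ) ^ ((∑ j, (colength (ν j) : ℤ)) - (m : ℤ)) *
    ((∑ a ∈ Finset.univ.filter (fun a : Fin l → Fin L => StrictMono a),
        ∏ i, c (a i) ^ colength (μ i)) *
      ∑ b ∈ Finset.univ.filter (fun b : Fin m → Fin M => Monotone b),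
        ∏ j, d (b j) ^ colength (ν j))

/-- The symmetrized weight `𝒲_{c,d}(𝛍;𝛎)`. -/
noncomputable def Wsym {N L M l m : ℕ} (c : Fin L → ℂ) (d : Fin M → ℂ)
    (μ : Fin l → Nat.Partition N) (ν : Fin m → Nat.Partition N) : ℂ :=
  ((-1 : ℂ) ^ ((∑ j, (colength (ν j) : ℤ)) - (m : ℤ)) /
      ((Nat.factorial l : ℂ) * (Nat.factorial m : ℂ))) *
    ∑ σ : Equiv.Perm (Fin l), ∑ σ' : Equiv.Perm (Fin m),
      (∑ a ∈ Finset.univ.filter (fun a : Fin l → Fin L => StrictMono a),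
          ∏ i, c (a i) ^ colength (μ (σ i))) *
        ∑ b ∈ Finset.univ.filter (fun b : Fin m → Fin M => Monotone b),
          ∏ j, d (b j) ^ colength (ν (σ' j))

/-- The rationally weighted double Hurwitz number `H^D_{G_{c,d}}(μ,ν)`. -/
noncomputable def ratHurwitz (N L M D : ℕ) (c : Fin L → ℂ) (d : Fin M → ℂ)
    (μ0 ν0 : Nat.Partition N) : ℂ :=
  ∑ l ∈ Finset.range (L + 1), ∑ m ∈ Finset.range (D + 1),
    ∑ p ∈ (Finset.univ :
          Finset ((Fin l → Nat.Partition N) × (Fin m → Nat.Partition N))).filter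
        (fun p => (∀ i, p.1 i ≠ trivialPartition N) ∧ (∀ j, p.2 j ≠ trivialPartition N) ∧
          (∑ i, colength (p.1 i)) + ∑ j, colength (p.2 j) = D),
      Wsym c d p.1 p.2 *
        (pureHurwitz N (List.ofFn p.1 ++ List.ofFn p.2 ++ [μ0, ν0]) : ℂ)


section ListLemmas

@[to_additive]
theorem prod_map_filter_of_eq_one {α R : Type*} [Monoid R] {p : α → Bool} {f : α → R}
    (hf : ∀ a, ¬ p a → f a = 1) (l : List α) : ((l.filter p).map f).prod = (l.map f).prod := by
  induction l with
  | nil => rfl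
  | cons a l ih => by_cases ha : p a <;> simp_all

/-- The lists over a finite type of length at most `n`. -/
noncomputable def listsLE (α : Type*) [Finite α] (n : ℕ) : Finset (List α) :=
  (List.finite_length_le α n).toFinset

theorem mem_listsLE {α : Type*} [Finite α] {n : ℕ} {x : List α} :
    x ∈ listsLE α n ↔ x.length ≤ n := by
  simp [listsLE]

theorem sum_range_sum_ofFn {α R : Type*} [Fintype α] [AddCommMonoid R] (F : List α → R) (n : ℕ) :
    ∑ m ∈ Finset.range (n + 1), ∑ v : Fin m → α, F (List.ofFn v) = ∑ x ∈ listsLE α n, F x := by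
  rw [Finset.sum_sigma']
  refine Finset.sum_bij (fun p _ => List.ofFn p.2) ?_ ?_ ?_ ?_
  · rintro ⟨m, v⟩ h
    simp only [Finset.mem_sigma, Finset.mem_range] at h
    rw [mem_listsLE, List.length_ofFn]
    exact Nat.le_of_lt_succ h.1
  · rintro ⟨m, v⟩ - ⟨m', v'⟩ - h
    exact List.ofFn_inj'.1 h
  · intro x hx
    rw [mem_listsLE] at hx
    exact ⟨⟨x.length, x.get⟩, by simpa using Nat.lt_succ_of_le hx, List.ofFn_get x⟩
  · exact fun _ _ => rfl

theorem sum_arrow_prod {ι α β R : Type*} [Fintype ι] [DecidableEq ι] [Fintype α] [Fintype β]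
    [AddCommMonoid R] (F : (ι → α × β) → R) :
    ∑ x, F x = ∑ u : ι → β, ∑ a : ι → α, F fun i => (a i, u i) := by
  rw [Finset.sum_comm, ← Fintype.sum_prod_type']
  exact Fintype.sum_equiv (Equiv.arrowProdEquivProdArrow ι (fun _ => α) fun _ => β) _ _ fun _ => rfl

variable {P : Type*} {n : ℕ}

/-- The list of pairs `(i, u i)` with `u i ≠ t`, in increasing order of `i`. -/
noncomputable def indexedSupport (t : P) (u : Fin n → P) : List (Fin n × P) :=
  ((List.finRange n).map fun i => (i, u i)).filter fun a => a.2 ≠ t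

theorem mem_indexedSupport {t : P} {u : Fin n → P} {a : Fin n × P} :
    a ∈ indexedSupport t u ↔ u a.1 = a.2 ∧ a.2 ≠ t := by
  rcases a with ⟨i, p⟩
  simp [indexedSupport]

theorem pairwise_indexedSupport (t : P) (u : Fin n → P) :
    (indexedSupport t u).Pairwise fun a b => a.1 < b.1 := by
  refine List.Pairwise.filter _ ?_
  rw [List.pairwise_map]
  exact List.pairwise_lt_finRange n

theorem length_indexedSupport_le (t : P) (u : Fin n → P) :
    (indexedSupport t u).length ≤ n :=
  (List.length_filter_le _ _).trans (by simp)

theorem indexedSupport_injective (t : P) :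
    Function.Injective (indexedSupport t : (Fin n → P) → List (Fin n × P)) := by
  intro u v h
  have hiff (i p) : u i = p ∧ p ≠ t ↔ v i = p ∧ p ≠ t := by
    rw [← mem_indexedSupport (a := (i, p)), h, mem_indexedSupport]
  funext i
  by_cases hu : u i = t
  · by_contra hne
    exact hne ((hiff i (v i)).2 ⟨rfl, fun hv => hne (hu.trans hv.symm)⟩).1
  · exact ((hiff i (u i)).1 ⟨rfl, hu⟩).1.symm

theorem exists_indexedSupport_eq {t : P} {x : List (Fin n × P)}
    (hx : x.Pairwise fun a b => a.1 < b.1) (ht : ∀ a ∈ x, a.2 ≠ t) :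
    ∃ u, indexedSupport t u = x := by
  have hirrefl : Std.Irrefl fun a b : Fin n × P => a.1 < b.1 := ⟨fun a => lt_irrefl a.1⟩
  have hasymm : Std.Asymm fun a b : Fin n × P => a.1 < b.1 := ⟨fun _ _ h => h.asymm⟩
  have huniq (i p q) (hp : (i, p) ∈ x) (hq : (i, q) ∈ x) : p = q := by
    have hnodup : (x.map Prod.fst).Nodup := by
      rw [List.Nodup, List.pairwise_map]
      exact hx.imp ne_of_lt
    exact congrArg Prod.snd (List.inj_on_of_nodup_map hnodup hp hq rfl)
  refine ⟨fun i => if h : ∃ p, (i, p) ∈ x then h.choose else t,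
    (pairwise_indexedSupport _ _).eq_of_mem_iff hx ?_⟩
  rintro ⟨i, p⟩
  rw [mem_indexedSupport]
  by_cases h : ∃ p, (i, p) ∈ x
  · simp only [dif_pos h]
    refine ⟨?_, fun hp => ⟨huniq _ _ _ h.choose_spec hp, ht _ hp⟩⟩
    rintro ⟨hp, -⟩
    exact hp ▸ h.choose_spec
  · simp only [dif_neg h]
    exact ⟨fun hp => absurd hp.1.symm hp.2, fun hp => absurd ⟨p, hp⟩ h⟩

theorem sum_indexedSupport {R : Type*} [Fintype P] [AddCommMonoid R] (t : P)
    (G : List (Fin n × P) → R) :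
    ∑ u, G (indexedSupport t u) = ∑ x ∈ (listsLE (Fin n × P) n).filter
      (fun x => x.Pairwise (fun a b => a.1 < b.1) ∧ ∀ a ∈ x, a.2 ≠ t), G x := by
  refine Finset.sum_bij (fun u _ => indexedSupport t u) ?_ ?_ ?_ fun _ _ => rfl
  · intro u _
    rw [Finset.mem_filter, mem_listsLE]
    exact ⟨length_indexedSupport_le t u, pairwise_indexedSupport t u,
      fun a ha => (mem_indexedSupport.1 ha).2⟩
  · exact fun u _ v _ h => indexedSupport_injective t h
  · intro x hx
    rw [Finset.mem_filter] at hx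
    obtain ⟨u, hu⟩ := exists_indexedSupport_eq hx.2.1 hx.2.2
    exact ⟨u, Finset.mem_univ u, hu⟩

@[to_additive]
theorem prod_map_indexedSupport {R : Type*} [CommMonoid R] {t : P} {g : Fin n × P → R}
    (hg : ∀ i, g (i, t) = 1) (u : Fin n → P) :
    ((indexedSupport t u).map g).prod = ∏ i, g (i, u i) := by
  rw [indexedSupport, prod_map_filter_of_eq_one, List.map_map, Fin.prod_univ_def]
  · rfl
  · rintro ⟨i, p⟩ hp
    obtain rfl : p = t := by simpa using hp
    exact hg i

theorem map_snd_indexedSupport (t : P) (u : Fin n → P) :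
    (indexedSupport t u).map Prod.snd = (List.ofFn u).filter (· ≠ t) := by
  rw [indexedSupport, List.ofFn_eq_map, List.filter_map, List.filter_map, List.map_map]
  rfl

/-- The concatenation of the lists `w i`, each entry being paired with its index `i`. -/
def indexedFlatten (w : Fin n → List P) : List (Fin n × P) :=
  (List.finRange n).flatMap fun i => (w i).map (Prod.mk i)

theorem mem_indexedFlatten {w : Fin n → List P} {a : Fin n × P} :
    a ∈ indexedFlatten w ↔ a.2 ∈ w a.1 := by
  rcases a with ⟨i, p⟩
  simp [indexedFlatten]

theorem pairwise_indexedFlatten (w : Fin n → List P) :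
    (indexedFlatten w).Pairwise fun a b => a.1 ≤ b.1 := by
  rw [indexedFlatten, List.pairwise_flatMap]
  refine ⟨fun i _ => ?_, (List.pairwise_lt_finRange n).imp fun h a ha b hb => ?_⟩
  · rw [List.pairwise_map]
    exact List.pairwise_of_forall fun _ _ => le_rfl
  · obtain ⟨_, -, rfl⟩ := List.mem_map.1 ha
    obtain ⟨_, -, rfl⟩ := List.mem_map.1 hb
    exact h.le

theorem map_snd_indexedFlatten (w : Fin n → List P) :
    (indexedFlatten w).map Prod.snd = (List.ofFn w).flatten := by
  simp [indexedFlatten, List.ofFn_eq_map, List.flatMap_def, Function.comp_def]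

@[to_additive]
theorem prod_map_indexedFlatten {R : Type*} [CommMonoid R] (g : Fin n × P → R)
    (w : Fin n → List P) :
    ((indexedFlatten w).map g).prod = ∏ i, ((w i).map fun p => g (i, p)).prod := by
  rw [Fin.prod_univ_def]
  simp [indexedFlatten, List.flatMap_def, List.prod_flatten, Function.comp_def]

theorem indexedFlatten_injective :
    Function.Injective (indexedFlatten : (Fin n → List P) → List (Fin n × P)) := by
  have key (w : Fin n → List P) (i : Fin n) :
      ((indexedFlatten w).filter fun a => a.1 = i).map Prod.snd = w i := by
    have hflat (K : List (Fin n)) (hK : K.Nodup) :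
        ((K.flatMap fun j => (w j).map (Prod.mk j)).filter fun a => a.1 = i).map Prod.snd =
          if i ∈ K then w i else [] := by
      induction K with
      | nil => rfl
      | cons k K ih =>
        rw [List.nodup_cons] at hK
        rw [List.flatMap_cons, List.filter_append, List.map_append, ih hK.2]
        by_cases hki : k = i
        · subst hki
          simp [hK.1, List.filter_map, Function.comp_def]
        · simp [hki, Ne.symm hki, List.filter_map, Function.comp_def]
    rw [indexedFlatten, hflat _ (List.nodup_finRange n), if_pos (List.mem_finRange i)]
  intro w w' h
  funext i
  rw [← key w, h, key w']

theorem flatMap_filter_eq_of_pairwise {K : List (Fin n)} (hK : K.Pairwise (· < ·))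
    {y : List (Fin n × P)} (hy : y.Pairwise fun a b => a.1 ≤ b.1) (hmem : ∀ a ∈ y, a.1 ∈ K) :
    (K.flatMap fun i => y.filter fun a => a.1 = i) = y := by
  have hsplit (k : Fin n) (y : List (Fin n × P)) (hy : y.Pairwise fun a b => a.1 ≤ b.1)
      (hk : ∀ a ∈ y, k ≤ a.1) :
      (y.filter fun a => a.1 = k) ++ (y.filter fun a => a.1 ≠ k) = y := by
    induction y with
    | nil => rfl
    | cons a y ih =>
      rw [List.pairwise_cons] at hy
      by_cases ha : a.1 = k
      · simpa [ha] using ih hy.2 fun b hb => hk b (List.mem_cons_of_mem a hb)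
      · have hlt : k < a.1 := lt_of_le_of_ne (hk a List.mem_cons_self) (Ne.symm ha)
        have hne : ∀ b ∈ y, b.1 ≠ k := fun b hb => (hlt.trans_le (hy.1 b hb)).ne'
        have h1 : (y.filter fun a => a.1 = k) = [] := by simpa [List.filter_eq_nil_iff] using hne
        have h2 : (y.filter fun a => a.1 ≠ k) = y := by simpa [List.filter_eq_self] using hne
        rw [List.filter_cons_of_neg (by simpa using ha), List.filter_cons_of_pos (by simpa using ha),
          h1, h2, List.nil_append]
  induction K generalizing y with
  | nil =>
    have hnil : y = [] := List.eq_nil_iff_forall_not_mem.2 fun a ha => by simpa using hmem a ha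
    rw [hnil, List.flatMap_nil]
  | cons k K ih =>
    rw [List.pairwise_cons] at hK
    have hk : ∀ a ∈ y, k ≤ a.1 := fun a ha => by
      rcases List.mem_cons.1 (hmem a ha) with h | h
      · exact h.ge
      · exact (hK.1 _ h).le
    have htail := ih hK.2 (hy.filter fun a => a.1 ≠ k) fun a ha => by
      rw [List.mem_filter] at ha
      exact (List.mem_cons.1 (hmem a ha.1)).resolve_left (by simpa using ha.2)
    conv_rhs => rw [← hsplit k y hy hk, ← htail]
    rw [List.flatMap_cons]
    congr 1
    refine List.flatMap_congr fun i hi => ?_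
    rw [List.filter_filter]
    refine List.filter_congr fun a _ => ?_
    have := (hK.1 i hi).ne'
    by_cases hai : a.1 = i <;> simp_all

theorem exists_indexedFlatten_eq {y : List (Fin n × P)}
    (hy : y.Pairwise fun a b => a.1 ≤ b.1) : ∃ w, indexedFlatten w = y := by
  refine ⟨fun i => (y.filter fun a => a.1 = i).map Prod.snd, ?_⟩
  conv_rhs => rw [← flatMap_filter_eq_of_pairwise (List.pairwise_lt_finRange n) hy
    fun a _ => List.mem_finRange a.1]
  rw [indexedFlatten]
  refine List.flatMap_congr fun i _ => ?_
  rw [List.map_map]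
  refine (List.map_congr_left fun a ha => ?_).trans (List.map_id _)
  rw [List.mem_filter] at ha
  exact Prod.ext (of_decide_eq_true ha.2).symm rfl

end ListLemmas

variable {N : ℕ}

theorem HasCycleType.conj {h : Equiv.Perm (Fin N)} {μ : Nat.Partition N}
    (hh : HasCycleType h μ) (g : Equiv.Perm (Fin N)) : HasCycleType (g * h * g⁻¹) μ := by
  unfold HasCycleType fullCycleType at *
  rwa [Equiv.Perm.cycleType_conj]

theorem hasCycleType_trivialPartition_iff {h : Equiv.Perm (Fin N)} :
    HasCycleType h (trivialPartition N) ↔ h = 1 := by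
  unfold HasCycleType fullCycleType trivialPartition
  refine ⟨fun hh => ?_, ?_⟩
  · dsimp only at hh
    rw [← Equiv.Perm.cycleType_eq_zero, Multiset.eq_zero_iff_forall_notMem]
    intro k hk
    have h2 := Equiv.Perm.two_le_of_mem_cycleType hk
    have : k ∈ Multiset.replicate N 1 := hh ▸ Multiset.mem_add.2 (Or.inl hk)
    rw [Multiset.eq_of_mem_replicate this] at h2
    omega
  · rintro rfl
    simp

theorem colength_trivialPartition : colength (trivialPartition N) = 0 := by
  simp [colength, trivialPartition]

theorem one_le_colength {μ : Nat.Partition N} (hμ : μ ≠ trivialPartition N) :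
    1 ≤ colength μ := by
  by_contra! h
  apply hμ
  have h1 : ∀ x ∈ μ.parts, 1 ≤ x := fun x hx => μ.parts_pos hx
  have hle : μ.parts.card ≤ N := by
    have := Multiset.card_nsmul_le_sum h1
    rw [μ.parts_sum] at this
    simpa using this
  have hcard : μ.parts.card = N := by
    unfold colength at h
    omega
  ext1
  rw [trivialPartition, Multiset.eq_replicate]
  refine ⟨hcard, fun b hb => ?_⟩
  obtain ⟨t, ht⟩ := Multiset.exists_cons_of_mem hb
  have ht1 : t.card ≤ t.sum := by
    have := Multiset.card_nsmul_le_sum (s := t) (a := 1)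
      fun x hx => h1 x (ht ▸ Multiset.mem_cons_of_mem hx)
    simpa using this
  have hs := μ.parts_sum
  have hb1 := h1 b hb
  rw [ht] at hs hcard
  simp only [Multiset.sum_cons, Multiset.card_cons] at hs hcard
  omega

/-- The sum of all permutations of cycle type `μ` in the rational group algebra. -/
noncomputable def classSum (μ : Nat.Partition N) : MonoidAlgebra ℚ (Equiv.Perm (Fin N)) :=
  ∑ h : Equiv.Perm (Fin N), if HasCycleType h μ then MonoidAlgebra.of ℚ _ h else 0

theorem classSum_trivialPartition : classSum (trivialPartition N) = 1 := by
  simp only [classSum, hasCycleType_trivialPartition_iff]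
  rw [Finset.sum_ite_eq' Finset.univ 1]
  simp [MonoidAlgebra.one_def]

theorem commute_of_classSum (g : Equiv.Perm (Fin N)) (μ : Nat.Partition N) :
    Commute (MonoidAlgebra.of ℚ _ g) (classSum μ) := by
  unfold Commute SemiconjBy classSum
  rw [Finset.mul_sum, Finset.sum_mul]
  refine Fintype.sum_equiv (MulAut.conj g).toEquiv _ _ fun h => ?_
  have hiff : HasCycleType (g * h * g⁻¹) μ ↔ HasCycleType h μ :=
    ⟨fun hh => by simpa [mul_assoc] using hh.conj g⁻¹, fun hh => hh.conj g⟩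
  simp only [MulEquiv.toEquiv_eq_coe, MulEquiv.coe_toEquiv, MulAut.conj_apply, hiff]
  split_ifs
  · rw [← map_mul, ← map_mul]
    simp
  · simp

theorem commute_classSum (μ ν : Nat.Partition N) : Commute (classSum μ) (classSum ν) := by
  rw [classSum]
  refine Commute.sum_left _ _ _ fun h _ => ?_
  split_ifs
  · exact commute_of_classSum h ν
  · exact Commute.zero_left _

theorem prod_map_classSum (l : List (Nat.Partition N)) :
    (l.map classSum).prod = ∑ h : Fin l.length → Equiv.Perm (Fin N),
      if ∀ i, HasCycleType (h i) (l.get i) then MonoidAlgebra.of ℚ _ (List.ofFn h).prod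
      else 0 := by
  induction l with
  | nil => simp [MonoidAlgebra.one_def]
  | cons μ l ih =>
    rw [List.map_cons, List.prod_cons, ih, classSum, Finset.sum_mul_sum,
      ← Fintype.sum_prod_type']
    refine Fintype.sum_equiv (Fin.consEquiv fun _ : Fin (l.length + 1) => Equiv.Perm (Fin N)) _ _
      fun p => ?_
    simp only [Fin.consEquiv, Equiv.coe_fn_mk, List.length_cons, Fin.forall_fin_succ,
      Fin.cons_zero, Fin.cons_succ, List.ofFn_cons, List.prod_cons, List.get_eq_getElem,
      Fin.val_zero, Fin.val_succ, List.getElem_cons_zero, List.getElem_cons_succ, map_mul]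
    split_ifs <;> simp_all

theorem hurwitzCount_eq_coeff (l : List (Nat.Partition N)) :
    (hurwitzCount N l : ℚ) = (l.map classSum).prod.coeff 1 := by
  rw [prod_map_classSum, hurwitzCount, Nat.card_eq_fintype_card, Fintype.card_subtype,
    Finset.card_filter, MonoidAlgebra.coeff_sum, Finsupp.finsetSum_apply]
  push_cast
  refine Finset.sum_congr rfl fun h _ => ?_
  by_cases h1 : ∀ i, HasCycleType (h i) (l.get i)
  · rw [if_pos h1, MonoidAlgebra.of_apply, MonoidAlgebra.coeff_single, Finsupp.single_apply]
    simp only [h1, implies_true, and_true]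
  · rw [if_neg h1, if_neg fun h2 => h1 h2.2, MonoidAlgebra.coeff_zero, Finsupp.zero_apply]

theorem pureHurwitz_congr {l l' : List (Nat.Partition N)}
    (h : (l.filter (· ≠ trivialPartition N)).Perm (l'.filter (· ≠ trivialPartition N))) :
    pureHurwitz N l = pureHurwitz N l' := by
  have hfilter (l : List (Nat.Partition N)) :
      ((l.filter (· ≠ trivialPartition N)).map classSum).prod = (l.map classSum).prod :=
    prod_map_filter_of_eq_one (fun μ hμ => by
      rw [show μ = trivialPartition N by simpa using hμ, classSum_trivialPartition]) l
  have key : (l.map classSum).prod = (l'.map classSum).prod := by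
    rw [← hfilter l, ← hfilter l']
    refine (h.map classSum).prod_eq' (List.pairwise_of_forall_mem_list ?_)
    simp only [List.mem_map]
    rintro _ ⟨μ, -, rfl⟩ _ ⟨ν, -, rfl⟩
    exact commute_classSum μ ν
  rw [pureHurwitz, pureHurwitz, hurwitzCount_eq_coeff, hurwitzCount_eq_coeff, key]

theorem pureHurwitz_congr_of_perm {l l' : List (Nat.Partition N)} (h : l.Perm l') :
    pureHurwitz N l = pureHurwitz N l' :=
  pureHurwitz_congr (h.filter _)

section Weights

variable {L M l m : ℕ} (c : Fin L → ℂ) (d : Fin M → ℂ)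

theorem Wsym_eq_sum_Wun (μ : Fin l → Nat.Partition N) (ν : Fin m → Nat.Partition N) :
    Wsym c d μ ν = ((Nat.factorial l : ℂ) * (Nat.factorial m : ℂ))⁻¹ *
      ∑ σ : Equiv.Perm (Fin l), ∑ σ' : Equiv.Perm (Fin m), Wun c d (μ ∘ σ) (ν ∘ σ') := by
  have hsum (σ' : Equiv.Perm (Fin m)) :
      ∑ j, (colength (ν (σ' j)) : ℤ) = ∑ j, (colength (ν j) : ℤ) :=
    Equiv.sum_comp σ' fun j => (colength (ν j) : ℤ)
  simp only [Wsym, Wun, Function.comp_apply, hsum, ← Finset.mul_sum]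
  ring

/-- The pairs of tuples of nontrivial partitions of total colength `D`. -/
noncomputable def nontrivialPairs (N l m D : ℕ) :
    Finset ((Fin l → Nat.Partition N) × (Fin m → Nat.Partition N)) :=
  Finset.univ.filter fun p =>
    (∀ i, p.1 i ≠ trivialPartition N) ∧ (∀ j, p.2 j ≠ trivialPartition N) ∧
      (∑ i, colength (p.1 i)) + ∑ j, colength (p.2 j) = D

theorem sum_Wsym_mul_pureHurwitz (D : ℕ) (μ0 ν0 : Nat.Partition N) :
    ∑ p ∈ nontrivialPairs N l m D, Wsym c d p.1 p.2 *
        (pureHurwitz N (List.ofFn p.1 ++ List.ofFn p.2 ++ [μ0, ν0]) : ℂ) =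
      ∑ p ∈ nontrivialPairs N l m D, Wun c d p.1 p.2 *
        (pureHurwitz N (List.ofFn p.1 ++ List.ofFn p.2 ++ [μ0, ν0]) : ℂ) := by
  set S := ∑ p ∈ nontrivialPairs N l m D, Wun c d p.1 p.2 *
        (pureHurwitz N (List.ofFn p.1 ++ List.ofFn p.2 ++ [μ0, ν0]) : ℂ) with hS
  have hreindex (σ : Equiv.Perm (Fin l)) (σ' : Equiv.Perm (Fin m)) :
      ∑ p ∈ nontrivialPairs N l m D, Wun c d (p.1 ∘ σ) (p.2 ∘ σ') *
        (pureHurwitz N (List.ofFn p.1 ++ List.ofFn p.2 ++ [μ0, ν0]) : ℂ) = S := by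
    rw [hS]
    refine Finset.sum_equiv
      ((Equiv.arrowCongr σ.symm (Equiv.refl _)).prodCongr
        (Equiv.arrowCongr σ'.symm (Equiv.refl _))) (fun p => ?_) fun p _ => ?_
    · have h1 : (∀ i, (p.1 ∘ σ) i ≠ trivialPartition N) ↔ ∀ i, p.1 i ≠ trivialPartition N :=
        σ.forall_congr_left.trans (by simp)
      have h2 : (∀ j, (p.2 ∘ σ') j ≠ trivialPartition N) ↔ ∀ j, p.2 j ≠ trivialPartition N :=
        σ'.forall_congr_left.trans (by simp)
      have h3 : ∑ i, colength ((p.1 ∘ σ) i) = ∑ i, colength (p.1 i) :=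
        Equiv.sum_comp σ fun i => colength (p.1 i)
      have h4 : ∑ j, colength ((p.2 ∘ σ') j) = ∑ j, colength (p.2 j) :=
        Equiv.sum_comp σ' fun j => colength (p.2 j)
      change _ ↔ (p.1 ∘ σ, p.2 ∘ σ') ∈ nontrivialPairs N l m D
      rw [nontrivialPairs, Finset.mem_filter, Finset.mem_filter]
      simp only [Finset.mem_univ, true_and, h1, h2, h3, h4]
    · change _ = Wun c d (p.1 ∘ σ) (p.2 ∘ σ') * (pureHurwitz N
        (List.ofFn (p.1 ∘ σ) ++ List.ofFn (p.2 ∘ σ') ++ [μ0, ν0]) : ℂ)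
      rw [pureHurwitz_congr_of_perm (((σ.ofFn_comp_perm p.1).append
        (σ'.ofFn_comp_perm p.2)).append_right [μ0, ν0])]
  simp only [Wsym_eq_sum_Wun, mul_assoc, Finset.sum_mul, ← Finset.mul_sum]
  rw [Finset.sum_comm]
  simp only [Finset.sum_comm (s := nontrivialPairs N l m D), hreindex, Finset.sum_const,
    Finset.card_univ, Fintype.card_perm, Fintype.card_fin, nsmul_eq_mul]
  have := Nat.cast_ne_zero (R := ℂ).2 (Nat.factorial_ne_zero l)
  have := Nat.cast_ne_zero (R := ℂ).2 (Nat.factorial_ne_zero m)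
  field_simp

/-- The signed weight times the Hurwitz number attached to lists of partitions labelled by
the indices of the parameters `c` and `d`. -/
noncomputable def labelledTerm (μ0 ν0 : Nat.Partition N) (x : List (Fin L × Nat.Partition N))
    (y : List (Fin M × Nat.Partition N)) : ℂ :=
  (-1 : ℂ) ^ (((y.map fun a => (colength a.2 : ℤ)).sum) - (y.length : ℤ)) *
    (x.map fun a => c a.1 ^ colength a.2).prod * (y.map fun a => d a.1 ^ colength a.2).prod *
    (pureHurwitz N (x.map Prod.snd ++ y.map Prod.snd ++ [μ0, ν0]) : ℂ)

/-- The labelled lists of nontrivial partitions, with weakly increasing labels and total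
colength `E` when increased by `C`. -/
def IsWeakLabelling (C E : ℕ) (y : List (Fin M × Nat.Partition N)) : Prop :=
  y.Pairwise (fun a b => a.1 ≤ b.1) ∧ (∀ a ∈ y, a.2 ≠ trivialPartition N) ∧
    C + (y.map fun a => colength a.2).sum = E

theorem IsWeakLabelling.length_le {C E : ℕ} {y : List (Fin M × Nat.Partition N)}
    (hy : IsWeakLabelling C E y) : y.length ≤ E := by
  have h := List.card_nsmul_le_sum (y.map fun a => colength a.2) 1 <| by
    simp only [List.mem_map]
    rintro _ ⟨a, ha, rfl⟩
    exact one_le_colength (hy.2.1 a ha)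
  rw [List.length_map, smul_eq_mul, mul_one] at h
  have := hy.2.2
  omega

theorem sum_Wun_mul_pureHurwitz (D : ℕ) (μ0 ν0 : Nat.Partition N) :
    ∑ p ∈ nontrivialPairs N l m D, Wun c d p.1 p.2 *
        (pureHurwitz N (List.ofFn p.1 ++ List.ofFn p.2 ++ [μ0, ν0]) : ℂ) =
      ∑ x : Fin l → Fin L × Nat.Partition N, ∑ y : Fin m → Fin M × Nat.Partition N,
        if (List.ofFn x).Pairwise (fun a b => a.1 < b.1) ∧
            ∀ a ∈ List.ofFn x, a.2 ≠ trivialPartition N then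
          if IsWeakLabelling (((List.ofFn x).map fun a => colength a.2).sum) D (List.ofFn y) then
            labelledTerm c d μ0 ν0 (List.ofFn x) (List.ofFn y)
          else 0
        else 0 := by
  rw [sum_arrow_prod, nontrivialPairs, Finset.sum_filter, Fintype.sum_prod_type]
  refine Finset.sum_congr rfl fun u _ => ?_
  simp_rw [sum_arrow_prod (ι := Fin m)]
  rw [Finset.sum_comm]
  refine Finset.sum_congr rfl fun v _ => ?_
  have hstrict (a : Fin l → Fin L) :
      (List.ofFn fun i => (a i, u i)).Pairwise (fun a b => a.1 < b.1) ↔ StrictMono a :=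
    List.pairwise_ofFn
  have hmono (b : Fin m → Fin M) :
      (List.ofFn fun i => (b i, v i)).Pairwise (fun a b => a.1 ≤ b.1) ↔ Monotone b :=
    List.pairwise_ofFn.trans monotone_iff_forall_lt.symm
  simp only [hstrict, IsWeakLabelling, hmono, List.forall_mem_ofFn_iff, List.map_ofFn,
    List.sum_ofFn, labelledTerm, List.prod_ofFn, List.length_ofFn, Function.comp_def]
  split_ifs with h
  · rw [Wun, Finset.sum_filter, Finset.sum_filter, Finset.sum_mul_sum]
    simp only [Finset.mul_sum, Finset.sum_mul]
    refine Finset.sum_congr rfl fun a _ => ?_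
    refine Finset.sum_congr rfl fun b _ => ?_
    by_cases ha : StrictMono a
    · by_cases hb : Monotone b
      · rw [if_pos ha, if_pos hb, if_pos ⟨ha, h.1⟩, if_pos ⟨hb, h.2⟩]
        ring
      · rw [if_neg hb, if_neg (c := Monotone b ∧ _) fun hb' => hb hb'.1, ite_self, mul_zero,
          mul_zero, zero_mul]
    · rw [if_neg ha, if_neg (c := StrictMono a ∧ _) fun ha' => ha ha'.1, zero_mul, mul_zero,
        zero_mul]
  · refine (Finset.sum_eq_zero fun a _ => Finset.sum_eq_zero fun b _ => ?_).symm
    split_ifs with h1 h2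
    · exact absurd ⟨h1.2, h2.2⟩ h
    · rfl
    · rfl

theorem ratHurwitz_eq_sum_labelledTerm (D : ℕ) (μ0 ν0 : Nat.Partition N) :
    ratHurwitz N L M D c d μ0 ν0 =
      ∑ u : Fin L → Nat.Partition N, ∑ y ∈ (listsLE (Fin M × Nat.Partition N) D).filter
        (IsWeakLabelling (∑ i, colength (u i)) D),
          labelledTerm c d μ0 ν0 (indexedSupport (trivialPartition N) u) y := by
  have hcolength (u : Fin L → Nat.Partition N) : ∑ i, colength (u i) =
      ((indexedSupport (trivialPartition N) u).map fun a => colength a.2).sum :=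
    (sum_map_indexedSupport (g := fun a => colength a.2) (fun _ => colength_trivialPartition) u).symm
  have hleft : ratHurwitz N L M D c d μ0 ν0 = ∑ l ∈ Finset.range (L + 1),
      ∑ m ∈ Finset.range (D + 1), ∑ p ∈ nontrivialPairs N l m D, Wsym c d p.1 p.2 *
        (pureHurwitz N (List.ofFn p.1 ++ List.ofFn p.2 ++ [μ0, ν0]) : ℂ) := rfl
  simp_rw [hleft, sum_Wsym_mul_pureHurwitz, sum_Wun_mul_pureHurwitz, hcolength,
    Finset.sum_filter]
  rw [sum_indexedSupport (trivialPartition N) fun x =>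
    ∑ y ∈ listsLE (Fin M × Nat.Partition N) D,
      if IsWeakLabelling ((x.map fun a => colength a.2).sum) D y then
        labelledTerm c d μ0 ν0 x y else 0, Finset.sum_filter, ← sum_range_sum_ofFn]
  refine Finset.sum_congr rfl fun l _ => ?_
  rw [Finset.sum_comm]
  refine Finset.sum_congr rfl fun x _ => ?_
  split_ifs with hx
  · rw [← sum_range_sum_ofFn]
  · simp

theorem labelledTerm_indexedSupport_indexedFlatten (μ0 ν0 : Nat.Partition N)
    (u : Fin L → Nat.Partition N) (w : Fin M → List (Nat.Partition N)) :
    labelledTerm c d μ0 ν0 (indexedSupport (trivialPartition N) u) (indexedFlatten w) =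
      (-1 : ℂ) ^ ((∑ i, (((w i).map colength).sum : ℤ)) - ∑ i, ((w i).length : ℤ)) *
        (∏ i, c i ^ colength (u i)) *
        (∏ i, ((w i).map (fun p => d i ^ colength p)).prod) *
        (pureHurwitz N (List.ofFn u ++ (List.ofFn w).flatten ++ [μ0, ν0]) : ℂ) := by
  have hlength : ((indexedFlatten w).length : ℤ) = ∑ i, ((w i).length : ℤ) := by
    have := sum_map_indexedFlatten (fun _ => (1 : ℤ)) w
    simpa using this
  have hsum : ((indexedFlatten w).map fun a => (colength a.2 : ℤ)).sum =
      ∑ i, (((w i).map colength).sum : ℤ) := by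
    rw [sum_map_indexedFlatten]
    refine Finset.sum_congr rfl fun i _ => ?_
    rw [Nat.cast_list_sum, List.map_map]
    rfl
  have hprod : ((indexedSupport (trivialPartition N) u).map fun a => c a.1 ^ colength a.2).prod =
      ∏ i, c i ^ colength (u i) :=
    prod_map_indexedSupport (g := fun a => c a.1 ^ colength a.2)
      (fun i => by rw [colength_trivialPartition, pow_zero]) u
  have hH : pureHurwitz N ((indexedSupport (trivialPartition N) u).map Prod.snd ++
      (indexedFlatten w).map Prod.snd ++ [μ0, ν0]) =
      pureHurwitz N (List.ofFn u ++ (List.ofFn w).flatten ++ [μ0, ν0]) := by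
    refine pureHurwitz_congr (List.Perm.of_eq ?_)
    rw [map_snd_indexedSupport, map_snd_indexedFlatten]
    simp [List.filter_append, List.filter_filter]
  rw [labelledTerm, hlength, hsum, hprod, hH, prod_map_indexedFlatten]

theorem bijOn_indexedFlatten (C E : ℕ) :
    Set.BijOn (indexedFlatten : (Fin M → List (Nat.Partition N)) → _)
      {w | (∀ i, ∀ p ∈ w i, p ≠ trivialPartition N) ∧ C + ∑ i, ((w i).map colength).sum = E}
      {y | IsWeakLabelling C E y} := by
  have hiff (w : Fin M → List (Nat.Partition N)) : IsWeakLabelling C E (indexedFlatten w) ↔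
      (∀ i, ∀ p ∈ w i, p ≠ trivialPartition N) ∧ C + ∑ i, ((w i).map colength).sum = E := by
    simp only [IsWeakLabelling, pairwise_indexedFlatten, true_and, mem_indexedFlatten,
      sum_map_indexedFlatten, Prod.forall]
  refine ⟨fun w hw => (hiff w).2 hw, indexedFlatten_injective.injOn, fun y hy => ?_⟩
  obtain ⟨w, rfl⟩ := exists_indexedFlatten_eq hy.1
  exact ⟨w, (hiff w).1 hy, rfl⟩

end Weights

/-- The rationally weighted double Hurwitz number `H^D_{G_{c,d}}(μ,ν)` equals
the sum, over all `L`-tuples `(μ̃^{(1)},…,μ̃^{(L)})` of arbitrary partitions of `N` and all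
`M`-tuples of finite sequences `𝛎^{(i)} = (ν^{(i,1)},…,ν^{(i,J_i)})` of nontrivial partitions
of `N` of total colength `D`, of the signed products of weights times the corresponding pure
Hurwitz numbers — the combinatorial content of the weighted constellation expansion of the
τ-function. -/
theorem ratHurwitz_eq_constellation_sum (N L M D : ℕ) (hN : 0 < N)
    (μ0 ν0 : Nat.Partition N) (c : Fin L → ℂ) (d : Fin M → ℂ) :
    ratHurwitz N L M D c d μ0 ν0 =
      ∑ μt : Fin L → Nat.Partition N,
        ∑ᶠ (νs : Fin M → List (Nat.Partition N))
            (_ : (∀ i, ∀ p ∈ νs i, p ≠ trivialPartition N) ∧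
              (∑ i, colength (μt i)) + ∑ i, ((νs i).map colength).sum = D),
          (-1 : ℂ) ^ ((∑ i, (((νs i).map colength).sum : ℤ)) - ∑ i, ((νs i).length : ℤ)) *
            (∏ i, c i ^ colength (μt i)) *
            (∏ i, ((νs i).map (fun p => d i ^ colength p)).prod) *
            (pureHurwitz N (List.ofFn μt ++ (List.ofFn νs).flatten ++ [μ0, ν0]) : ℂ) := by

  rw [ratHurwitz_eq_sum_labelledTerm]
  refine Finset.sum_congr rfl fun u _ => ?_
  rw [← finsum_mem_coe_finset]
  have hset : (↑((listsLE (Fin M × Nat.Partition N) D).filter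
      (IsWeakLabelling (∑ i, colength (u i)) D)) : Set (List (Fin M × Nat.Partition N))) =
      {y | IsWeakLabelling (∑ i, colength (u i)) D y} := by
    ext y
    simp only [Finset.coe_filter, mem_listsLE, Set.mem_ofPred_eq, and_iff_right_iff_imp]
    exact IsWeakLabelling.length_le
  rw [hset]
  refine (finsum_mem_eq_of_bijOn indexedFlatten
    (bijOn_indexedFlatten (∑ i, colength (u i)) D) fun w _ => ?_).symm
  exact (labelledTerm_indexedSupport_indexedFlatten c d μ0 ν0 u w).symm
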